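/- For all positive integers η, n, d there exists an integer ηcB(n,d), independent of N and of K, such that for every algebraically closed field K, every N, and every graded K-vector subspace V of R = K[x_1,…,x_N] of K-dimension at most n whose nonzero homogeneous elements are forms of positive degree at most d, the elements of V are contained in a subring K[G_1,…,G_B] of R, where B ≤ ηcB(n,d) and G_1,…,G_B is an R_η-sequence of forms of positive degree at most d. -/

import Mathlib

open MvPolynomial

/-- The height of an ideal: the infimum of the heights of the prime ideals containing it
(so the unit ideal has height `⊤`). -/
noncomputable def idealHeight {R : Type*} [CommRing R] (I : Ideal R) : ℕ∞ :=
  ⨅ (P : PrimeSpectrum R) (_ : I ≤ P.asIdeal), Order.height P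

/-- A Noetherian local ring is regular if its maximal ideal is generated by
(Krull dimension)-many elements. -/
def IsRegularLocal (A : Type*) [CommRing A] [IsLocalRing A] : Prop :=
  IsNoetherianRing A ∧
    ∃ s : Finset A, Ideal.span (s : Set A) = IsLocalRing.maximalIdeal A ∧
      (s.card : WithBot ℕ∞) = ringKrullDim A

/-- Serre's condition `R_η` for a ring `A`: for every prime ideal `P` of `A` of height
at most `η`, the localization of `A` at `P` is a regular local ring. -/
def SerreConditionR (η : ℕ) (A : Type*) [CommRing A] : Prop :=
  ∀ (P : Ideal A) [hP : P.IsPrime],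
    Order.height (⟨P, hP⟩ : PrimeSpectrum A) ≤ (η : ℕ∞) →
      IsRegularLocal (Localization.AtPrime P)

/-- `G` is an `R_η`-sequence: it generates a proper ideal and the quotient of the ring by the
ideal generated by each initial segment satisfies Serre's condition `R_η`. -/
def IsRnSequence (η : ℕ) {R : Type*} [CommRing R] {s : ℕ} (G : Fin s → R) : Prop :=
  Ideal.span (Set.range G) ≠ ⊤ ∧
    ∀ i : ℕ, i ≤ s →
      SerreConditionR η (R ⧸ Ideal.span (G '' {j : Fin s | (j : ℕ) < i}))

/-- `F`, a form of degree `d`, has a `k`-collapse: `F` lies in an ideal generated by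
`k` forms of strictly smaller positive degree.  A form of degree `d` has strength at
least `s` iff it has no `s`-collapse. -/
def HasCollapse {K : Type*} [CommSemiring K] {σ : Type*} (d k : ℕ)
    (F : MvPolynomial σ K) : Prop :=
  ∃ (G : Fin k → MvPolynomial σ K) (e : Fin k → ℕ),
    (∀ i, 0 < e i ∧ e i < d ∧ (G i).IsHomogeneous (e i)) ∧
    F ∈ Ideal.span (Set.range G)

theorem exists_subset_isTranscendenceBasis_isSeparable (K : Type*) {L : Type*} [Field K]
    [PerfectField K] [Field L] [Algebra K L] {N : ℕ} (x : Fin N → L)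
    (hx : IntermediateField.adjoin K (Set.range x) = ⊤) :
    ∃ s : Set (Fin N), IsTranscendenceBasis K (fun i : s ↦ x i) ∧
      Algebra.IsSeparable (IntermediateField.adjoin K (x '' s)) L := by
  have hbasis : ∃ s : Set (Fin N), IsTranscendenceBasis K (fun i : s ↦ x i) := by
    have : Algebra.IsAlgebraic (Algebra.adjoin K (Set.range x)) L := by
      rw [← IntermediateField.isAlgebraic_adjoin_iff_top, hx,
        Algebra.isAlgebraic_iff_isIntegral]
      exact Algebra.isIntegral_of_surjective IntermediateField.topEquiv.surjective
    obtain ⟨t, hts, ht⟩ := exists_isTranscendenceBasis_subset (R := K) (Set.range x)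
    choose f hf using hts
    have hinj : Function.Injective (fun i : t ↦ f i.2) := by
      intro i j hij
      have := congrArg x hij
      simp only [hf] at this
      exact Subtype.ext this
    let e := Equiv.ofInjective _ hinj
    refine ⟨Set.range (fun i : t ↦ f i.2), ?_⟩
    have : ((↑) : t → L) = (fun i : Set.range (fun i : t ↦ f i.2) ↦ x i) ∘ e := by
      ext i
      simp [e, hf]
    rw [this] at ht
    exact (isTranscendenceBasis_equiv e).mp ht
  obtain _ | ⟨p, hp, hpk⟩ := CharP.exists' K
  · obtain ⟨s, hs⟩ := hbasis
    have : Algebra.IsAlgebraic (IntermediateField.adjoin K (x '' s)) L := by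
      convert! hs.isAlgebraic_field <;> ext <;> simp
    exact ⟨s, hs, inferInstance⟩
  have : ExpChar K p := .prime hp.out
  have : CharP L p := .of_ringHom_of_ne_zero (algebraMap K L) p hp.out.ne_zero
  have H : ∀ s : Finset L, LinearIndepOn K _root_.id (s : Set L) →
      LinearIndepOn K (· ^ p) (s : Set L) := fun s hs ↦ by
    apply hs.map_of_injective_injective (frobeniusEquiv K p).symm (frobenius L p).toAddMonoidHom <;>
      simp [frobenius_def, Algebra.smul_def, mul_pow, ← map_pow, frobeniusEquiv_symm_pow]
  obtain ⟨s, hs, hmax⟩ := Set.Finite.exists_maximalFor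
    (fun s : Set (Fin N) ↦ (separableClosure (IntermediateField.adjoin K (x '' s))
        L).restrictScalars K)
    {s | IsTranscendenceBasis K (fun i : s ↦ x i)} (Set.toFinite _) hbasis
  refine ⟨s, hs, ?_⟩
  by_contra hns
  obtain ⟨n, hn⟩ : ∃ n, ¬ IsSeparable (IntermediateField.adjoin K (x '' s)) (x n) := by
    by_contra! hall
    refine hns ?_
    rw [← separableClosure.eq_top_iff, ← (IntermediateField.restrictScalars_injective K).eq_iff,
      IntermediateField.restrictScalars_top, eq_top_iff, ← hx, IntermediateField.adjoin_le_iff]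
    rintro _ ⟨i, rfl⟩
    exact hall i
  have hns : n ∉ s := fun h ↦ hn (le_restrictScalars_separableClosure _
    (IntermediateField.subset_adjoin _ _ ⟨n, h, rfl⟩))
  have ⟨i, hi₁, hi₂⟩ := exists_isTranscendenceBasis_and_isSeparable_of_linearIndepOn_pow'
    p hp.out (a := x) H s n hs hns
  refine not_lt_iff_le_imp_ge.mpr (hmax hi₁) (SetLike.lt_iff_le_and_exists.mpr
    ⟨?_, x n, ?_, hn⟩)
  · rw [separableClosure_le_separableClosure_iff, IntermediateField.adjoin_le_iff]
    rintro _ ⟨j, hj, rfl⟩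
    obtain rfl | ne := eq_or_ne j i
    exacts [hi₂, le_restrictScalars_separableClosure _
      (IntermediateField.subset_adjoin _ _ ⟨j, ⟨.inr hj, ne⟩, rfl⟩)]
  · obtain rfl | ne := eq_or_ne n i
    exacts [hi₂, le_restrictScalars_separableClosure _
      (IntermediateField.subset_adjoin _ _ ⟨n, ⟨.inl rfl, ne⟩, rfl⟩)]

theorem exists_algHom_lift_of_isTranscendenceBasis {K L B σ : Type*} [Field K] [Field L]
    [Algebra K L]
    [CommRing B] [Algebra K B] (x : σ → L) {s : Set σ}
    (hs : IsTranscendenceBasis K (fun i : s ↦ x i))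
    (hsep : Algebra.IsSeparable (IntermediateField.adjoin K (x '' s)) L)
    (I : Ideal B) (hI : IsNilpotent I) (φ : L →ₐ[K] B ⧸ I) (y : s → B)
    (hy : ∀ k : s, Ideal.Quotient.mk I (y k) = φ (x k)) :
    ∃ E : L →ₐ[K] B, (∀ a, Ideal.Quotient.mk I (E a) = φ a) ∧ ∀ k : s, E (x k) = y k := by
  have himg : Set.range (fun i : s ↦ x i) = x '' s := by ext; simp
  rw [← himg] at hsep
  set v : s → L := fun i ↦ x i with hv
  let A := Algebra.adjoin K (Set.range v)
  open scoped IntermediateField.algebraAdjoinAdjoin in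
  have h1 : Algebra.FormallySmooth A (IntermediateField.adjoin K (Set.range v)) :=
    .of_isLocalization (nonZeroDivisors _)
  have h2 : Algebra.FormallyEtale (IntermediateField.adjoin K (Set.range v)) L :=
    Algebra.FormallyEtale.of_isSeparable _ L
  open scoped IntermediateField.algebraAdjoinAdjoin in
  have h3 : Algebra.FormallySmooth A L :=
    .comp _ (IntermediateField.adjoin K (Set.range v)) _
  let f : A →ₐ[K] B := (aeval y).comp hs.1.aevalEquiv.symm.toAlgHom
  have hf : ∀ k, f ⟨v k, Algebra.subset_adjoin ⟨k, rfl⟩⟩ = y k := by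
    intro k
    have : (⟨v k, Algebra.subset_adjoin ⟨k, rfl⟩⟩ : A) = hs.1.aevalEquiv (X k) := by
      ext; simp [hv]
    rw [this]
    simp [f]
  let : Algebra A B := f.toAlgebra
  have : IsScalarTower K A B := IsScalarTower.of_algebraMap_eq' f.comp_algebraMap.symm
  have key : φ.comp A.val = (Ideal.Quotient.mkₐ K I).comp f := by
    have : (φ.comp A.val).comp hs.1.aevalEquiv.toAlgHom =
        ((Ideal.Quotient.mkₐ K I).comp f).comp hs.1.aevalEquiv.toAlgHom := by
      ext k
      simp [f, hy, hv]
    ext a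
    simpa using DFunLike.congr_fun this (hs.1.aevalEquiv.symm a)
  let φ' : L →ₐ[A] B ⧸ I := { φ with commutes' := fun a ↦ DFunLike.congr_fun key a }
  let E := Algebra.FormallySmooth.lift I hI φ'
  refine ⟨E.restrictScalars K, fun a ↦ Algebra.FormallySmooth.mk_lift I hI φ' a, fun k ↦ ?_⟩
  rw [← hf k, AlgHom.coe_restrictScalars']
  exact E.commutes (⟨v k, Algebra.subset_adjoin ⟨k, rfl⟩⟩ : A)

theorem card_le_height_of_forall_exists_aeval_X_mem {A : Type*} [CommRing A] [IsDomain A]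
    [IsNoetherianRing A]
    (κ : Type*) [Finite κ] (P : Ideal (MvPolynomial κ A)) [P.IsPrime]
    (hP : ∀ a : A, C a ∈ P → a = 0)
    (halg : ∀ i : κ, ∃ q : Polynomial A, q ≠ 0 ∧ Polynomial.aeval (X i : MvPolynomial κ A) q ∈ P) :
    (Nat.card κ : ℕ∞) ≤ P.height := by
  induction κ using Finite.induction_empty_option with
  | @of_equiv α β f ih =>
    let e := renameEquiv A f
    have hQ : (P.comap e).IsPrime := Ideal.comap_isPrime e P
    have h := ih (P.comap e) (fun a ha ↦ hP a (by simpa [e] using ha)) fun i ↦ by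
      obtain ⟨q, hq, hqP⟩ := halg (f i)
      refine ⟨q, hq, ?_⟩
      rw [Ideal.mem_comap, ← Polynomial.aeval_algHom_apply]
      simpa [e] using hqP
    rw [← Nat.card_congr f]
    exact h.trans_eq (e.toRingEquiv.height_comap P)
  | h_empty => simp
  | @h_option α _ ih =>
    let e := optionEquivLeft A α
    let p := P.comap (rename some : MvPolynomial α A →ₐ[A] _)
    let Q := P.comap e.symm
    have hp : p.IsPrime := Ideal.comap_isPrime _ P
    have hQ : Q.IsPrime := Ideal.comap_isPrime _ P
    have hsymm : ∀ f : MvPolynomial α A, e.symm (Polynomial.C f) = rename some f := by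
      intro f
      rw [AlgEquiv.symm_apply_eq]
      induction f using MvPolynomial.induction_on with
      | C a => simp [e]
      | add f g hf hg => simp [hf, hg]
      | mul_X f i hf => simp [hf, e]
    have h := ih p (fun a ha ↦ hP a (by simpa [p] using ha)) fun i ↦ by
      obtain ⟨q, hq, hqP⟩ := halg (some i)
      refine ⟨q, hq, ?_⟩
      rw [Ideal.mem_comap, ← Polynomial.aeval_algHom_apply]
      simpa using hqP
    have hlies : Q.LiesOver p := ⟨by
      ext f
      simp [p, Q, Ideal.under_def, hsymm]⟩
    have hle : p.map Polynomial.C ≤ Q := by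
      rw [Ideal.map_le_iff_le_comap, hlies.over]
      exact le_rfl
    have hne : p.map Polynomial.C ≠ Q := by
      intro heq
      have hmapC : ∀ q : Polynomial A, q.map (C : A →+* MvPolynomial α A) =
          Polynomial.aeval (Polynomial.X : Polynomial (MvPolynomial α A)) q := by
        intro q
        induction q using Polynomial.induction_on' with
        | add p q hp hq => simp [hp, hq]
        | monomial k a =>
          rw [Polynomial.map_monomial, Polynomial.aeval_monomial,
            ← Polynomial.C_mul_X_pow_eq_monomial]
          rfl
      obtain ⟨q, hq, hqP⟩ := halg none
      refine hq (Polynomial.ext fun n ↦ hP _ ?_)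
      have hmem : q.map C ∈ Q := by
        rw [Ideal.mem_comap]
        convert hqP
        rw [AlgEquiv.symm_apply_eq, ← Polynomial.aeval_algHom_apply]
        simp only [e, optionEquivLeft_X_none]
        exact hmapC q
      rw [← heq, Ideal.mem_map_C_iff] at hmem
      simpa [p] using hmem n
    have h2 : p.height ≤ (p.map Polynomial.C).height := by
      have : (p.map Polynomial.C).LiesOver p := ⟨by
        ext f
        rw [Ideal.under_def]
        change f ∈ p ↔ Polynomial.C f ∈ Ideal.map Polynomial.C p
        rw [Ideal.mem_map_C_iff]
        refine ⟨fun hf n ↦ ?_, fun hf ↦ by simpa using hf 0⟩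
        rw [Polynomial.coeff_C]
        split_ifs <;> simp [hf]⟩
      rw [Ideal.height_eq_height_add_of_liesOver_of_hasGoingDown p (p.map Polynomial.C)]
      exact le_self_add
    rw [Finite.card_option]
    push_cast
    calc (Nat.card α : ℕ∞) + 1 ≤ (p.map Polynomial.C).height + 1 := by gcongr; exact h.trans h2
      _ ≤ Q.height := Ideal.height_add_one_le_of_lt_of_isPrime (lt_of_le_of_ne hle hne)
      _ = P.height := e.symm.toRingEquiv.height_comap P

theorem ncard_compl_le_height {K L : Type*} [Field K] [Field L] [Algebra K L] {σ : Type*} [Finite σ]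
    (P : Ideal (MvPolynomial σ K)) [P.IsPrime] (x : σ → L) (hPx : ∀ f, f ∈ P ↔ aeval x f = 0)
    (s : Set σ) (hs : IsTranscendenceBasis K (fun i : s ↦ x i)) :
    (Nat.card (sᶜ : Set σ) : ℕ∞) ≤ P.height := by
  classical
  let e : MvPolynomial (↥sᶜ) (MvPolynomial s K) ≃ₐ[K] MvPolynomial σ K :=
    (sumAlgEquiv K (↥sᶜ) s).symm.trans (renameEquiv K
        ((Equiv.sumComm _ _).trans (Equiv.Set.sumCompl s)))
  have hQ : (P.comap e).IsPrime := Ideal.comap_isPrime e P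
  have hC : ∀ f : MvPolynomial s K, e (C f) = rename (↑) f := by
    intro f
    induction f using MvPolynomial.induction_on with
    | C a => simp [e]
    | add f g hf hg => simp only [map_add, hf, hg]
    | mul_X f i hf => simp only [map_mul, hf]; simp [e]
  have hCP : ∀ f : MvPolynomial s K, e (C f) ∈ P ↔ f = 0 := by
    intro f
    rw [hPx, hC, aeval_rename]
    refine ⟨fun h ↦ ?_, fun h ↦ by simp [h]⟩
    exact (algebraicIndependent_iff.mp hs.1) f h
  have hX : ∀ i : (sᶜ : Set σ), e (X i) = X i.1 := by
    intro i; simp [e]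
  rw [← e.toRingEquiv.height_comap P]
  refine card_le_height_of_forall_exists_aeval_X_mem _ (P.comap e) (fun a ha ↦ (hCP a).mp ha) fun
      i ↦ ?_
  let f : MvPolynomial s K →ₐ[K] L := aeval fun i : s ↦ x i
  have hfinj : Function.Injective f := hs.1
  have halg : IsAlgebraic (Algebra.adjoin K (Set.range fun i : s ↦ x i)) (x i) :=
      hs.isAlgebraic.isAlgebraic _
  obtain ⟨q, hq, hq0⟩ := halg
  refine ⟨q.map (hs.1.aevalEquiv.symm : _ →+* _), ?_, ?_⟩
  · rwa [Ne, Polynomial.map_eq_zero_iff hs.1.aevalEquiv.symm.injective]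
  · rw [Ideal.mem_comap, hPx, ← hq0]
    have haeval : ∀ b : Algebra.adjoin K (Set.range fun i : s ↦ x i),
        aeval x (e (C (hs.1.aevalEquiv.symm b))) = (b : L) := by
      intro b
      obtain ⟨f, rfl⟩ := hs.1.aevalEquiv.surjective b
      rw [AlgEquiv.symm_apply_apply, hC, aeval_rename]
      simp [Function.comp_def]
    clear hq hq0
    induction q using Polynomial.induction_on' with
    | add p q hp hq => simp only [Polynomial.map_add, map_add, hp, hq]
    | monomial k a =>
      rw [Polynomial.map_monomial, Polynomial.aeval_monomial, Polynomial.aeval_monomial, map_mul,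
        map_mul, map_pow, map_pow, hX, aeval_X]
      congr 1
      exact haeval a

theorem aeval_add_eq_of_mul_eq_zero {R S σ : Type*} [CommRing R] [CommRing S] [Algebra R S]
    [Fintype σ] (p δ : σ → S) (hδ : ∀ i j, δ i * δ j = 0) (F : MvPolynomial σ R) :
    aeval (fun i ↦ p i + δ i) F = aeval p F + ∑ i, aeval p (pderiv i F) * δ i := by
  classical
  induction F using MvPolynomial.induction_on with
  | C a => simp
  | add f g hf hg =>
    simp only [map_add, hf, hg, add_mul, Finset.sum_add_distrib]
    ring
  | mul_X f k hf =>
    have h1 : ∑ i, aeval p (pderiv i f) * δ i * δ k = 0 :=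
      Finset.sum_eq_zero fun i _ ↦ by rw [mul_assoc, hδ, mul_zero]
    have h2 : ∑ i, aeval p f * aeval p (Pi.single (M := fun _ ↦ MvPolynomial σ R) i 1 k) * δ i
        = aeval p f * δ k := by
      rw [Finset.sum_eq_single k (fun i _ hi ↦ by simp [Pi.single_eq_of_ne hi.symm]) (by simp)]
      simp
    simp only [map_mul, hf, aeval_X, Derivation.leibniz, pderiv_X, map_add, smul_eq_mul, add_mul,
      Finset.sum_add_distrib, h2, mul_add, Finset.sum_mul, h1]
    rw [add_zero, add_assoc]
    congr 1
    rw [add_comm]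
    congr 1
    exact Finset.sum_congr rfl fun i _ ↦ by ring

theorem homogeneousComponent_succ_mul_X {R σ : Type*} [CommSemiring R] (f : MvPolynomial σ R)
    (i : σ) (k : ℕ) :
    homogeneousComponent (k + 1) (f * X i) = homogeneousComponent k f * X i := by
  classical
  ext m
  rw [coeff_homogeneousComponent, coeff_mul_X', coeff_mul_X', coeff_homogeneousComponent]
  by_cases hm : i ∈ m.support
  · have : m.degree = (m - Finsupp.single i 1).degree + 1 := by
      have h : Finsupp.single i 1 ≤ m := by
        rw [Finsupp.single_le_iff]
        exact Nat.one_le_iff_ne_zero.mpr (by simpa using hm)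
      conv_lhs => rw [← tsub_add_cancel_of_le h]
      simp
    simp [hm, this]
  · simp [hm]

theorem homogeneousComponent_aeval_C_add_X {R σ : Type*} [CommRing R] (x : σ → R) {e : ℕ}
    {F : MvPolynomial σ R} (hF : F.totalDegree ≤ e) :
    homogeneousComponent e (aeval (fun i ↦ C (x i) + X i : σ → MvPolynomial σ R) F) =
      homogeneousComponent e F := by
  classical
  set T : MvPolynomial σ R →ₐ[R] MvPolynomial σ R := aeval fun i ↦ C (x i) + X i
  have key : ∀ (m : σ →₀ ℕ) (a : R), ∃ k, (monomial m a).IsHomogeneous k ∧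
      (T (monomial m a)).totalDegree ≤ k ∧
      homogeneousComponent k (T (monomial m a)) = monomial m a := by
    refine induction_on_monomial (fun a ↦ ⟨0, isHomogeneous_C _ _, ?_, ?_⟩) fun p i ↦ ?_
    · simp [T]
    · simp [T, algebraMap_eq]
    · rintro ⟨k, hpk, hk, hc⟩
      refine ⟨k + 1, hpk.mul (isHomogeneous_X _ _), ?_, ?_⟩
      · rw [map_mul]
        refine (totalDegree_mul _ _).trans (add_le_add hk ?_)
        simp only [T, aeval_X]
        refine (totalDegree_add _ _).trans (max_le (by simp) ?_)
        exact (isHomogeneous_X R i).totalDegree_le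
      · rw [map_mul]
        simp only [T, aeval_X]
        rw [mul_add, map_add, homogeneousComponent_succ_mul_X, hc, mul_comm _ (C _),
          homogeneousComponent_C_mul, homogeneousComponent_eq_zero _ _ (Nat.lt_succ_of_le hk),
          mul_zero, zero_add]
  conv_lhs => rw [F.as_sum]
  conv_rhs => rw [F.as_sum]
  simp only [map_sum]
  refine Finset.sum_congr rfl fun m hm ↦ ?_
  obtain ⟨k, hk, hle, hc⟩ := key m (coeff m F)
  have hkm : m.degree = k := by
    rw [Finsupp.degree_eq_weight_one]
    exact hk (by rw [coeff_monomial, if_pos rfl]; simpa using hm)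
  have hke : k ≤ e := by
    rw [← hkm]
    exact (le_totalDegree hm).trans hF
  rcases hke.eq_or_lt with rfl | hlt
  · rw [hc, homogeneousComponent_eq_self hk]
  · rw [homogeneousComponent_eq_zero _ _ (hle.trans_lt hlt),
      homogeneousComponent_eq_zero _ _ (hk.totalDegree_le.trans_lt hlt)]

theorem sub_eval_mem_idealOfVars {R σ : Type*} [CommRing R] (x : σ → R) (F : MvPolynomial σ R) :
    aeval (fun i ↦ C (x i) + X i : σ → MvPolynomial σ R) F - C (eval x F) ∈ idealOfVars σ R := by
  rw [← Ideal.Quotient.eq]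
  induction F using MvPolynomial.induction_on with
  | C a => simp [algebraMap_eq]
  | add f g hf hg => simp only [map_add, hf, hg]
  | mul_X f i hf =>
    have h : Ideal.Quotient.mk (idealOfVars σ R) (X i) = 0 :=
      Ideal.Quotient.eq_zero_iff_mem.mpr (Ideal.subset_span ⟨i, rfl⟩)
    simp only [map_mul, hf, aeval_X, map_add, h, add_zero, eval_X]

theorem homogeneousComponent_mem_span_of_aeval_mem {R σ : Type*} [CommRing R] [Finite σ] {e : ℕ}
    (he : 0 < e) {F : MvPolynomial σ R} (hF : F.totalDegree ≤ e) (x : σ → R)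
    (hdF : ∀ i, eval x (pderiv i F) = 0) (l : σ → MvPolynomial σ R)
    (hl : ∀ i, l i ∈ idealOfVars σ R)
    (h : aeval (fun i ↦ C (x i) + X i - l i) F ∈ idealOfVars σ R ^ (e + 1)) :
    homogeneousComponent e F ∈ Ideal.span
      (Set.range fun p : σ × Fin (e - 1) ↦ homogeneousComponent (p.2 + 1) (l p.1)) := by
  let : GradedAlgebra (homogeneousSubmodule σ R) := gradedAlgebra
  cases nonempty_fintype σ
  set J := Ideal.span
      (Set.range fun p : σ × Fin (e - 1) ↦ homogeneousComponent (p.2 + 1) (l p.1)) with hJ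
  have hJhom : J.IsHomogeneous (homogeneousSubmodule σ R) := by
    refine Ideal.homogeneous_span _ _ ?_
    rintro _ ⟨p, rfl⟩
    exact ⟨_, homogeneousComponent_mem _ _⟩
  let 𝔪 := idealOfVars σ R
  have hlm : ∀ i, l i ∈ J ⊔ 𝔪 ^ e := by
    intro i
    rw [← sum_homogeneousComponent (l i)]
    refine Ideal.sum_mem _ fun k _ ↦ ?_
    rcases lt_or_ge k e with hk | hk
    · refine Ideal.mem_sup_left ?_
      rcases k with _ | k
      · have := hl i
        rw [← pow_one (idealOfVars σ R), mem_pow_idealOfVars_iff] at this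
        rw [homogeneousComponent_eq_zero']
        · exact J.zero_mem
        · exact fun m hm ↦ Nat.one_le_iff_ne_zero.mp (this m hm)
      · exact Ideal.subset_span ⟨(i, ⟨k, by lia⟩), rfl⟩
    · refine Ideal.mem_sup_right ((mem_pow_idealOfVars_iff _ _).mpr fun m hm ↦ ?_)
      rw [support_homogeneousComponent, Finset.mem_filter] at hm
      exact hm.2 ▸ hk
  let π := Ideal.Quotient.mk (J ⊔ 𝔪 ^ (e + 1))
  have hπ : ∀ f ∈ 𝔪, ∀ i, π f * π (l i) = 0 := by
    intro f hf i
    rw [← map_mul, Ideal.Quotient.eq_zero_iff_mem]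
    have := Ideal.mul_mem_mul hf (hlm i)
    rw [Ideal.mul_sup, ← pow_succ'] at this
    exact sup_le_sup_right (Ideal.mul_le_right (I := 𝔪) (J := J)) _ this
  have htaylor := aeval_add_eq_of_mul_eq_zero (R := R) (fun i ↦ π (C (x i) + X i))
    (fun i ↦ - π (l i)) (fun i j ↦ by simp [hπ _ (hl i) j]) F
  have hpi : ∀ (g : σ → MvPolynomial σ R) (f : MvPolynomial σ R),
      aeval (fun i ↦ π (g i)) f = π (aeval g f) := by
    intro g f
    exact (comp_aeval_apply (f := g) (Ideal.Quotient.mkₐ R (J ⊔ 𝔪 ^ (e + 1))) f).symm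
  have hmem : aeval (fun i ↦ C (x i) + X i : σ → MvPolynomial σ R) F ∈ J ⊔ 𝔪 ^ (e + 1) := by
    rw [← Ideal.Quotient.eq_zero_iff_mem]
    have hsum : ∑ i, aeval (fun i ↦ π (C (x i) + X i)) (pderiv i F) * - π (l i) = 0 := by
      refine Finset.sum_eq_zero fun i _ ↦ ?_
      have := sub_eval_mem_idealOfVars x (pderiv i F)
      rw [hdF, C_0, sub_zero] at this
      rw [hpi, mul_neg, hπ _ this, neg_zero]
    simp only [← sub_eq_add_neg, ← map_sub] at htaylor
    simp only [sub_eq_add_neg, ← map_neg] at htaylor hsum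
    rw [hsum, add_zero, hpi] at htaylor
    rw [← hpi, ← htaylor]
    simp only [← sub_eq_add_neg]
    rw [Ideal.Quotient.eq_zero_iff_mem]
    exact Ideal.mem_sup_right h
  rw [← homogeneousComponent_aeval_C_add_X x hF]
  obtain ⟨a, ha, b, hb, hab⟩ := Submodule.mem_sup.mp hmem
  rw [← hab, map_add, homogeneousComponent_eq_zero' _ b, add_zero]
  · exact homogeneousComponent_mem_of_mem hJhom ha e
  · intro m hm
    have := (mem_pow_idealOfVars_iff _ _).mp hb m hm
    lia

/-- Some nonzero linear combination of members of `F` of a common degree `e` lies in an ideal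
generated by `h` forms of each positive degree smaller than `e`. -/
def HasCollapsingCombination {K σ ι : Type*} [Field K] [Fintype ι] (h : ℕ) (deg : ι → ℕ)
    (F : ι → MvPolynomial σ K) : Prop :=
  ∃ (e : ℕ) (α : ι → K), (∃ j, α j ≠ 0) ∧ (∀ j, α j ≠ 0 → deg j = e) ∧
    ∃ g : Fin h × Fin (e - 1) → MvPolynomial σ K,
      (∀ p, (g p).IsHomogeneous (p.2 + 1)) ∧
      ∑ j, C (α j) * F j ∈ Ideal.span (Set.range g)

theorem exists_aeval_C_add_X_sub_mem_idealOfVars_pow {K L σ : Type*} [Field K] [Field L]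
    [Algebra K L] (x : σ → L) {s : Set σ} (hs : IsTranscendenceBasis K (fun i : s ↦ x i))
    (hsep : Algebra.IsSeparable (IntermediateField.adjoin K (x '' s)) L) (e : ℕ) :
    ∃ l : σ → MvPolynomial σ L, (∀ i ∈ s, l i = 0) ∧ (∀ i, l i ∈ idealOfVars σ L) ∧
      ∀ f : MvPolynomial σ K, aeval x f = 0 →
        aeval (fun i ↦ C (x i) + X i - l i) f ∈ idealOfVars σ L ^ (e + 1) := by
  classical
  set 𝔪 := idealOfVars σ L with h𝔪
  let I : Ideal (MvPolynomial σ L ⧸ 𝔪 ^ (e + 1)) := 𝔪.map (Ideal.Quotient.mk (𝔪 ^ (e + 1)))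
  have hI : IsNilpotent I := ⟨e + 1,
      (Ideal.map_pow (Ideal.Quotient.mk (𝔪 ^ (e + 1))) 𝔪 (e + 1)).symm.trans
    (Ideal.map_quotient_self _)⟩
  let φ : L →ₐ[K] (MvPolynomial σ L ⧸ 𝔪 ^ (e + 1)) ⧸ I := IsScalarTower.toAlgHom K L _
  have hφ : ∀ c, φ c = Ideal.Quotient.mk I (Ideal.Quotient.mk (𝔪 ^ (e + 1)) (C c)) := fun c ↦ rfl
  have hmem : ∀ f, Ideal.Quotient.mk I (Ideal.Quotient.mk (𝔪 ^ (e + 1)) f) = 0 ↔ f ∈ 𝔪 := by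
    intro f
    rw [Ideal.Quotient.eq_zero_iff_mem]
    exact Ideal.mem_quotient_iff_mem (Ideal.pow_le_self e.succ_ne_zero)
  obtain ⟨E, hE, hEs⟩ := exists_algHom_lift_of_isTranscendenceBasis x hs hsep I hI φ
    (fun k ↦ Ideal.Quotient.mk _ (C (x k) + X k.1)) (fun k ↦ by
      rw [map_add, map_add, hφ, (hmem _).mpr (Ideal.subset_span ⟨k.1, rfl⟩), add_zero])
  choose w hw using fun i ↦ Ideal.Quotient.mk_surjective (E (x i))
  let l : σ → MvPolynomial σ L := fun i ↦ if i ∈ s then 0 else C (x i) + X i - w i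
  have hEl : ∀ i, Ideal.Quotient.mk (𝔪 ^ (e + 1)) (C (x i) + X i - l i) = E (x i) := by
    intro i
    by_cases hi : i ∈ s
    · simp only [l, if_pos hi, sub_zero]
      exact (hEs ⟨i, hi⟩).symm
    · simp only [l, if_neg hi, sub_sub_cancel, hw]
  refine ⟨l, fun i hi ↦ if_pos hi, fun i ↦ ?_, fun f hf ↦ ?_⟩
  · by_cases hi : i ∈ s
    · simp only [l, if_pos hi, Submodule.zero_mem]
    · simp only [l, if_neg hi]
      rw [← hmem, map_sub, map_sub, hw, hE, hφ, sub_eq_zero, map_add, map_add,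
        (hmem (X i)).mpr (Ideal.subset_span ⟨i, rfl⟩), add_zero]
  · have h1 := comp_aeval_apply (R := K) (f := fun i ↦ C (x i) + X i - l i)
      (Ideal.Quotient.mkₐ K (𝔪 ^ (e + 1))) f
    simp only [Ideal.Quotient.mkₐ_eq_mk, hEl] at h1
    rw [← Ideal.Quotient.eq_zero_iff_mem, h1, ← comp_aeval_apply, hf, map_zero]

theorem hasCollapsingCombination_map_of_sum_mul_aeval_pderiv {K L : Type*} [Field K] [Field L]
    [Algebra K L]
    [PerfectField K] {N : ℕ}
    (P : Ideal (MvPolynomial (Fin N) K)) [P.IsPrime] {h : ℕ} (hP : P.height ≤ h)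
    (x : Fin N → L) (hPx : ∀ f, f ∈ P ↔ aeval x f = 0)
    (hgen : IntermediateField.adjoin K (Set.range x) = ⊤)
    {ι : Type*} [Fintype ι] (F : ι → MvPolynomial (Fin N) K) (deg : ι → ℕ)
    (hdeg : ∀ j, 0 < deg j) (hF : ∀ j, (F j).IsHomogeneous (deg j)) (hFP : ∀ j, F j ∈ P)
    (β : ι → L) (hβ : ∃ j, β j ≠ 0) (hβF : ∀ i, ∑ j, β j * aeval x (pderiv i (F j)) = 0) :
    HasCollapsingCombination h deg fun j ↦ map (algebraMap K L) (F j) := by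
  classical
  obtain ⟨s, hs, hsep⟩ := exists_subset_isTranscendenceBasis_isSeparable K x hgen
  have hcard := (ncard_compl_le_height P x hPx s hs).trans hP
  obtain ⟨j₀, hj₀, hmax⟩ := Finset.exists_max_image (Finset.univ.filter fun j ↦ β j ≠ 0) deg
    (by simpa [Finset.filter_nonempty_iff] using hβ)
  replace hj₀ : β j₀ ≠ 0 := by simpa using hj₀
  replace hmax : ∀ j, β j ≠ 0 → deg j ≤ deg j₀ := by simpa using hmax
  set e := deg j₀ with he
  refine ⟨e, fun j ↦ if deg j = e then β j else 0, ⟨j₀, by simpa [e] using hj₀⟩, fun j hj ↦ ?_, ?_⟩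
  · by_contra hne
    exact hj (if_neg hne)
  set f : MvPolynomial (Fin N) L := ∑ j, C (β j) * map (algebraMap K L) (F j) with hf
  have hfdeg : f.totalDegree ≤ e := by
    refine totalDegree_finsetSum_le fun j _ ↦ ?_
    by_cases hj : β j = 0
    · simp [hj]
    · refine (((isHomogeneous_C _ _).mul ((hF j).map _)).totalDegree_le).trans ?_
      simpa using hmax j hj
  have hfe : homogeneousComponent e f =
      ∑ j, C (if deg j = e then β j else 0) * map (algebraMap K L) (F j) := by
    simp only [f, map_sum, homogeneousComponent_C_mul]
    refine Finset.sum_congr rfl fun j _ ↦ ?_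
    rw [homogeneousComponent_of_mem ((hF j).map _)]
    by_cases hj : deg j = e
    · rw [if_pos hj, if_pos hj.symm]
    · rw [if_neg hj, if_neg (Ne.symm hj), C_0, mul_zero, zero_mul]
  have hdf : ∀ i, eval x (pderiv i f) = 0 := by
    intro i
    rw [← hβF i]
    simp only [f, map_sum, pderiv_C_mul, pderiv_map, map_mul]
    simp [eval_map, aeval_def]
  obtain ⟨l, hls, hl, hlf⟩ := exists_aeval_C_add_X_sub_mem_idealOfVars_pow x hs hsep e
  have key := homogeneousComponent_mem_span_of_aeval_mem (hdeg j₀) hfdeg x hdf l hl (by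
    simp only [f, map_sum, map_mul, aeval_map_algebraMap]
    exact Ideal.sum_mem _ fun j _ ↦ Ideal.mul_mem_left _ _ (hlf _ ((hPx _).mp (hFP j))))
  rw [← he, hfe] at key
  obtain ⟨ψ⟩ : Nonempty ((sᶜ : Set (Fin N)) ↪ Fin h) := by
    rw [Function.Embedding.nonempty_iff_card_le, ← Nat.card_eq_fintype_card, Fintype.card_fin]
    exact_mod_cast hcard
  refine ⟨fun p ↦ Function.extend ψ (fun i ↦ homogeneousComponent (p.2 + 1) (l i)) 0 p.1, ?_, ?_⟩
  · intro p
    beta_reduce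
    by_cases hp : ∃ i, ψ i = p.1
    · obtain ⟨i, hi⟩ := hp
      rw [← hi, ψ.injective.extend_apply]
      exact homogeneousComponent_isHomogeneous _ _
    · rw [Function.extend_apply' _ _ _ hp]
      exact isHomogeneous_zero _ _ _
  · refine Ideal.span_le.mpr ?_ key
    rintro _ ⟨⟨i, t⟩, rfl⟩
    by_cases hi : i ∈ s
    · simp [hls i hi]
    · refine Ideal.subset_span ⟨(ψ ⟨i, hi⟩, t), ?_⟩
      simp only [ψ.injective.extend_apply]
theorem exists_algHom_of_finiteType {K : Type*} [Field K] [IsAlgClosed K] (A : Type*) [CommRing A]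
    [Nontrivial A] [Algebra K A] [Algebra.FiniteType K A] : Nonempty (A →ₐ[K] K) := by
  obtain ⟨M, hM⟩ := Ideal.exists_maximal A
  let := Ideal.Quotient.field M
  have : Algebra.FiniteType K (A ⧸ M) := .of_surjective (Ideal.Quotient.mkₐ K M)
      Ideal.Quotient.mk_surjective
  have : Module.Finite K (A ⧸ M) := finite_of_finite_type_of_isJacobsonRing K (A ⧸ M)
  exact ⟨(IsAlgClosed.lift (S := A ⧸ M) (M := K)).comp (Ideal.Quotient.mkₐ K M)⟩

theorem HasCollapsingCombination.of_map {K L σ ι : Type*} [Field K] [IsAlgClosed K] [Field L]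
    [Algebra K L] [Fintype ι] {h : ℕ} {deg : ι → ℕ} {F : ι → MvPolynomial σ K}
    (H : HasCollapsingCombination h deg fun j ↦ map (algebraMap K L) (F j)) :
    HasCollapsingCombination h deg F := by
  classical
  obtain ⟨e, α, ⟨j₀, hj₀⟩, hα, g, hg, hsum⟩ := H
  obtain ⟨c, hc⟩ := Ideal.mem_span_range_iff_exists_fun.mp hsum
  let T : Finset L := insert (α j₀)⁻¹ (Finset.univ.image α ∪
    Finset.univ.biUnion (fun p ↦ (g p).coeffs ∪ (c p).coeffs))
  let A := Algebra.adjoin K (T : Set L)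
  have : Algebra.FiniteType K A := (Subalgebra.fg_iff_finiteType _).mp ⟨T, rfl⟩
  have hTA : ∀ t ∈ T, t ∈ A := fun t ht ↦ Algebra.subset_adjoin ht
  have hinj : Function.Injective A.val := Subtype.val_injective
  have hlift : ∀ f : MvPolynomial σ L, f.coeffs ⊆ T →
      ∃ f' : MvPolynomial σ A, map (A.val : A →+* L) f' = f := by
    intro f hf
    refine mem_range_map_iff_coeffs_subset.mpr fun t ht ↦ ⟨⟨t, hTA t (hf ht)⟩, rfl⟩
  choose α' hα' using fun j ↦ (⟨⟨α j, hTA _ (by simp [T])⟩, rfl⟩ : ∃ a : A, A.val a = α j)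
  obtain ⟨u, hu⟩ : ∃ u : A, A.val u = (α j₀)⁻¹ :=
    ⟨⟨_, hTA _ (Finset.mem_insert_self _ _)⟩, rfl⟩
  choose g' hg' using fun p ↦ hlift (g p) (by
    intro t ht; simp only [T, Finset.mem_insert, Finset.mem_union, Finset.mem_biUnion]
    exact Or.inr (Or.inr ⟨p, Finset.mem_univ _, Or.inl ht⟩))
  choose c' hc' using fun p ↦ hlift (c p) (by
    intro t ht; simp only [T, Finset.mem_insert, Finset.mem_union, Finset.mem_biUnion]
    exact Or.inr (Or.inr ⟨p, Finset.mem_univ _, Or.inr ht⟩))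
  obtain ⟨ρ⟩ := exists_algHom_of_finiteType (K := K) A
  refine ⟨e, fun j ↦ ρ (α' j), ⟨j₀, ?_⟩, fun j hj ↦ hα j fun h0 ↦ ?_, fun p ↦ map (ρ : A →+* K)
      (g' p),
    fun p ↦ ?_, ?_⟩
  · have h1 : α' j₀ * u = 1 := hinj (by rw [map_mul, hα', hu, mul_inv_cancel₀ hj₀, map_one])
    intro h0
    simpa [h0] using congrArg ρ h1
  · rw [← hα', map_eq_zero_iff _ hinj] at h0
    simp [h0] at hj
  · refine IsHomogeneous.map (IsHomogeneous.of_map (f := (A.val : A →+* L)) hinj ?_) _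
    rw [hg']
    exact hg p
  · have hA : ∑ p, c' p * g' p = ∑ j, C (α' j) * map (algebraMap K A) (F j) := by
      apply map_injective (A.val : A →+* L) hinj
      simp only [map_sum, map_mul, hc', hg', map_C, map_map]
      rw [hc]
      refine Finset.sum_congr rfl fun j _ ↦ ?_
      congr 1
      rw [← hα']
      rfl
    have := congrArg (map (ρ : A →+* K)) hA
    rw [Ideal.mem_span_range_iff_exists_fun]
    refine ⟨fun p ↦ map (ρ : A →+* K) (c' p), ?_⟩
    simp only [map_sum, map_mul, map_C, map_map] at this
    rw [this]
    refine Finset.sum_congr rfl fun j _ ↦ ?_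
    congr 1
    have hρ : (ρ : A →+* K).comp (algebraMap K A) = RingHom.id K := ρ.comp_algebraMap
    rw [hρ, map_id]

theorem hasCollapsingCombination_of_sum_mul_pderiv_mem {K : Type*} [Field K] [IsAlgClosed K] {N : ℕ}
    (P : Ideal (MvPolynomial (Fin N) K)) [P.IsPrime] {h : ℕ} (hP : P.height ≤ h)
    {ι : Type*} [Fintype ι] {F : ι → MvPolynomial (Fin N) K} {deg : ι → ℕ}
    (hdeg : ∀ j, 0 < deg j) (hF : ∀ j, (F j).IsHomogeneous (deg j)) (hFP : ∀ j, F j ∈ P)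
    (a : ι → MvPolynomial (Fin N) K) (ha : ∃ j, a j ∉ P)
    (haF : ∀ i, ∑ j, a j * pderiv i (F j) ∈ P) : HasCollapsingCombination h deg F := by
  let π : MvPolynomial (Fin N) K →ₐ[K] FractionRing (MvPolynomial (Fin N) K ⧸ P) :=
    IsScalarTower.toAlgHom K _ _
  have hπ : ∀ f, f ∈ P ↔ π f = 0 := by
    intro f
    change _ ↔ algebraMap (MvPolynomial (Fin N) K ⧸ P)
      (FractionRing (MvPolynomial (Fin N) K ⧸ P)) (Ideal.Quotient.mk P f) = 0
    rw [FaithfulSMul.algebraMap_eq_zero_iff, Ideal.Quotient.eq_zero_iff_mem]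
  have hx : ∀ f, aeval (fun i ↦ π (X i)) f = π f := by
    intro f
    rw [← comp_aeval_apply]
    simp
  refine HasCollapsingCombination.of_map
    (hasCollapsingCombination_map_of_sum_mul_aeval_pderiv P hP (fun i ↦ π (X i))
      (fun f ↦ by rw [hx, hπ]) ?_ F deg hdeg hF hFP (fun j ↦ π (a j))
      (ha.imp fun j hj ↦ by rwa [Ne, ← hπ]) fun i ↦ ?_)
  · refine eq_top_iff.mpr fun z _ ↦ (IntermediateField.mem_adjoin_range_iff _ _ _).mpr ?_
    obtain ⟨p, q, hq, rfl⟩ := IsFractionRing.div_surjective (A := MvPolynomial (Fin N) K ⧸ P) z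
    obtain ⟨r, rfl⟩ := Ideal.Quotient.mk_surjective p
    obtain ⟨s, rfl⟩ := Ideal.Quotient.mk_surjective q
    exact ⟨r, s, by rw [hx, hx]; rfl⟩
  · simp only [hx, ← map_mul, ← map_sum]
    exact (hπ _).mp (haF i)

theorem IsRegularLocal.of_card_le {A : Type*} [CommRing A] [IsLocalRing A] [IsNoetherianRing A]
    {κ : Type*} [Fintype κ] (g : κ → A)
    (hg : Ideal.span (Set.range g) = IsLocalRing.maximalIdeal A)
    (hcard : (Fintype.card κ : WithBot ℕ∞) ≤ ringKrullDim A) : IsRegularLocal A := by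
  classical
  have hspan : Ideal.span ((Finset.univ.image g : Finset A) : Set A) =
      IsLocalRing.maximalIdeal A := by simpa using hg
  refine ⟨‹_›, Finset.univ.image g, hspan, le_antisymm ?_ ?_⟩
  · refine le_trans ?_ hcard
    exact_mod_cast Finset.card_image_le
  · refine (ringKrullDim_le_spanFinrank_maximalIdeal A).trans ?_
    rw [← hspan]
    have := Submodule.spanFinrank_span_le_ncard_of_finite (R := A)
      (Finset.finite_toSet (Finset.univ.image g))
    rw [Set.ncard_coe_finset] at this
    exact_mod_cast this

open IsLocalRing in
theorem exists_span_union_eq_maximalIdeal {S : Type*} [CommRing S] [IsLocalRing S]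
    [IsNoetherianRing S] {ι : Type*} [Fintype ι] (f : ι → maximalIdeal S)
    (hf : LinearIndependent (ResidueField S) fun j ↦ (maximalIdeal S).toCotangent (f j)) :
    ∃ (k : ℕ) (g : Fin k → S),
      Fintype.card ι + k = Module.finrank (ResidueField S) (CotangentSpace S) ∧
      Ideal.span (Set.range (fun j ↦ (f j : S)) ∪ Set.range g) = maximalIdeal S := by
  classical
  set v := fun j ↦ (maximalIdeal S).toCotangent (f j) with hv
  let b := Module.Basis.sumExtend hf
  have hbl (j) : b (Sum.inl j) = v j := by
    simp only [b, Module.Basis.sumExtend, Module.Basis.reindex_apply,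
        Module.Basis.extend_apply_self]
    rfl
  let := Module.Finite.finite_basis b
  have hfin : Finite (Module.Basis.sumExtendIndex hf) := Finite.of_injective _
      (Sum.inr_injective (α := ι))
  let := Fintype.ofFinite (Module.Basis.sumExtendIndex hf)
  let e := Fintype.equivFin (Module.Basis.sumExtendIndex hf)
  choose g hg using fun j ↦ Ideal.toCotangent_surjective (maximalIdeal S) (b (Sum.inr (e.symm j)))
  refine ⟨_, fun j ↦ g j, ?_, ?_⟩
  · rw [Module.finrank_eq_card_basis b, Fintype.card_sum]
  · have htop : Submodule.span (ResidueField S)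
        ((maximalIdeal S).toCotangent '' (Set.range f ∪ Set.range g)) = ⊤ := by
      rw [eq_top_iff, ← b.span_eq, Submodule.span_le]
      rintro _ ⟨j | j, rfl⟩
      · exact Submodule.subset_span ⟨f j, Or.inl ⟨j, rfl⟩, (hbl j).symm⟩
      · exact Submodule.subset_span ⟨g (e j), Or.inr ⟨e j, rfl⟩, by rw [hg, e.symm_apply_apply]⟩
    rw [CotangentSpace.span_image_eq_top_iff] at htop
    have := congrArg (Submodule.map (Submodule.subtype (maximalIdeal S))) htop
    rw [Submodule.map_span, Submodule.map_subtype_top, Set.image_union, ← Set.range_comp,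
      ← Set.range_comp] at this
    exact this

open IsLocalRing in
theorem exists_sum_mul_mem_sq_of_not_linearIndependent {R : Type*} [CommRing R] (P : Ideal R)
    [P.IsPrime] {ι : Type*} [Fintype ι] (F : ι → R)
    (f : ι → maximalIdeal (Localization.AtPrime P))
    (hf : ∀ j, (f j : Localization.AtPrime P) = algebraMap R _ (F j))
    (h : ¬ LinearIndependent (ResidueField (Localization.AtPrime P))
      fun j ↦ (maximalIdeal (Localization.AtPrime P)).toCotangent (f j)) :
    ∃ a : ι → R, (∃ j, a j ∉ P) ∧ ∑ j, a j * F j ∈ P ^ 2 := by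
  rw [Fintype.not_linearIndependent_iff] at h
  obtain ⟨c, hc, j₀, hj₀⟩ := h
  choose s hs using fun j ↦ residue_surjective (c j)
  obtain ⟨b, hb⟩ := IsLocalization.exist_integer_multiples_of_finite P.primeCompl s
  choose a ha using hb
  have hb' : IsUnit (algebraMap R (Localization.AtPrime P) b) := IsLocalization.map_units _ b
  have hmem : ∑ j, s j * (f j : Localization.AtPrime P) ∈ maximalIdeal (Localization.AtPrime P) ^
      2 := by
    have h0 : (maximalIdeal (Localization.AtPrime P)).toCotangent (∑ j, s j • f j) = 0 := by
      rw [map_sum, ← hc]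
      refine Finset.sum_congr rfl fun j _ ↦ ?_
      rw [map_smul, ← hs j]
      rfl
    rw [Ideal.toCotangent_eq_zero] at h0
    simpa using h0
  have hmem' : algebraMap R (Localization.AtPrime P) (∑ j, a j * F j) ∈
      (P ^ 2).map (algebraMap R (Localization.AtPrime P)) := by
    rw [Ideal.map_pow, Localization.AtPrime.map_eq_maximalIdeal, map_sum]
    convert Ideal.mul_mem_left _ (algebraMap R (Localization.AtPrime P) b) hmem using 1
    rw [Finset.mul_sum]
    refine Finset.sum_congr rfl fun j _ ↦ ?_
    rw [map_mul, ha, hf, ← mul_assoc, Algebra.smul_def]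
  obtain ⟨w, hw, hwmem⟩ := (IsLocalization.algebraMap_mem_map_algebraMap_iff P.primeCompl _ _
      _).mp hmem'
  refine ⟨fun j ↦ w * a j, ⟨j₀, fun hmem ↦ hj₀ ?_⟩, ?_⟩
  · have := (Ideal.IsPrime.mem_or_mem ‹_› hmem).resolve_left hw
    rw [← IsLocalization.AtPrime.to_map_mem_maximal_iff (Localization.AtPrime P) P, ha,
      Algebra.smul_def, Ideal.unit_mul_mem_iff_mem _ hb'] at this
    rw [← hs, residue_eq_zero_iff]
    exact this
  · simpa only [Finset.mul_sum, mul_assoc] using hwmem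

theorem pderiv_mem_of_mem_sq {R σ : Type*} [CommRing R] (P : Ideal (MvPolynomial σ R)) (i : σ)
    {f : MvPolynomial σ R} (hf : f ∈ P ^ 2) : pderiv i f ∈ P := by
  rw [pow_two] at hf
  induction hf using Submodule.mul_induction_on' with
  | mem_mul_mem p hp q hq =>
    rw [Derivation.leibniz]
    exact P.add_mem (P.mul_mem_right _ hp) (P.mul_mem_right _ hq)
  | add p _ q _ hp hq =>
    rw [map_add]
    exact P.add_mem hp hq

theorem serreConditionR_of_not_hasCollapsingCombination {K : Type*} [Field K] [IsAlgClosed K]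
    {N : ℕ} {ι : Type*} [Fintype ι] (η : ℕ) {F : ι → MvPolynomial (Fin N) K} {deg : ι → ℕ}
    (hdeg : ∀ j, 0 < deg j) (hF : ∀ j, (F j).IsHomogeneous (deg j))
    (h : ¬ HasCollapsingCombination (η + Fintype.card ι) deg F) :
    SerreConditionR η (MvPolynomial (Fin N) K ⧸ Ideal.span (Set.range F)) := by
  classical
  intro Q hQ hQη
  rw [← PrimeSpectrum.height_eq_orderHeight] at hQη
  set mk := Ideal.Quotient.mk (Ideal.span (Set.range F)) with hmk
  set P := Q.comap mk with hP
  have hFP (j : ι) : F j ∈ P := by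
    have : mk (F j) = 0 := Ideal.Quotient.eq_zero_iff_mem.mpr (Ideal.subset_span ⟨j, rfl⟩)
    rw [hP, Ideal.mem_comap, this]
    exact Q.zero_mem
  have hPQ : P.height ≤ Q.height + (Fintype.card ι : ℕ) := by
    refine (Ideal.height_le_height_add_encard_of_subset (Set.range F) (p := P)
      (Set.range_subset_iff.mpr hFP)).trans ?_
    rw [hP, Ideal.map_comap_of_surjective _ Ideal.Quotient.mk_surjective]
    gcongr
    rw [← Set.image_univ, ← Nat.card_eq_fintype_card, ← ENat.card_eq_coe_natCard, ← Set.encard_univ]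
    exact Set.encard_image_le _ _
  have hPη : P.height ≤ (η + Fintype.card ι : ℕ) := by
    refine hPQ.trans ?_
    push_cast
    gcongr
  have hreg : IsRegularLocalRing (Localization.AtPrime P) := inferInstance
  rw [IsRegularLocalRing.iff_finrank_cotangentSpace,
    IsLocalization.AtPrime.ringKrullDim_eq_height P] at hreg
  have hmem (j : ι) : algebraMap _ (Localization.AtPrime P) (F j) ∈
      IsLocalRing.maximalIdeal (Localization.AtPrime P) :=
    (IsLocalization.AtPrime.to_map_mem_maximal_iff _ P _).mpr (hFP j)
  by_cases hli : LinearIndependent (IsLocalRing.ResidueField (Localization.AtPrime P))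
      fun j ↦ (IsLocalRing.maximalIdeal (Localization.AtPrime P)).toCotangent ⟨_, hmem j⟩
  swap
  · obtain ⟨a, ha, haF⟩ := exists_sum_mul_mem_sq_of_not_linearIndependent P F _ (fun _ ↦ rfl) hli
    refine absurd (hasCollapsingCombination_of_sum_mul_pderiv_mem P hPη hdeg hF hFP a ha
      fun i ↦ ?_) h
    have := pderiv_mem_of_mem_sq P i haF
    simp only [map_sum, Derivation.leibniz, Finset.sum_add_distrib, smul_eq_mul] at this
    exact (P.add_mem_iff_left (P.sum_mem fun j _ ↦ P.mul_mem_right _ (hFP j))).mp this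
  obtain ⟨k, g, hk, hg⟩ := exists_span_union_eq_maximalIdeal _ hli
  rw [← hk] at hreg
  let φ := Localization.localRingHom P Q mk hP
  have hφ : Function.Surjective φ :=
    RingHom.surjectiveOnStalks_of_surjective Ideal.Quotient.mk_surjective Q hQ
  refine IsRegularLocal.of_card_le (φ ∘ g) ?_ ?_
  · rw [← IsLocalRing.map_maximalIdeal_of_surjective φ hφ, ← hg, Ideal.map_span, Set.image_union,
      ← Set.range_comp, ← Set.range_comp, Ideal.span_union]
    refine (sup_eq_right.mpr (Ideal.span_le.mpr ?_)).symm
    rintro _ ⟨j, rfl⟩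
    have hj : mk (F j) = 0 := Ideal.Quotient.eq_zero_iff_mem.mpr (Ideal.subset_span ⟨j, rfl⟩)
    have : φ (algebraMap _ _ (F j)) = 0 := by
      rw [Localization.localRingHom_to_map, hj, map_zero]
    simp [this]
  · rw [IsLocalization.AtPrime.ringKrullDim_eq_height Q, Fintype.card_fin]
    have h1 : ((Fintype.card ι + k : ℕ) : ℕ∞) = P.height := by exact_mod_cast hreg
    rw [← h1] at hPQ
    have h2 : (k : ℕ∞) ≤ Q.height := by
      push_cast at hPQ
      rw [add_comm] at hPQ
      exact (ENat.add_le_add_iff_right (ENat.natCast_ne_top _)).mp hPQ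
    exact_mod_cast h2

theorem HasCollapsingCombination.of_subtype {K σ ι : Type*} [Field K] [Fintype ι] (p : ι → Prop)
    [Fintype {j // p j}] {h h' : ℕ} (hh : h ≤ h') {deg : ι → ℕ} {F : ι → MvPolynomial σ K}
    (H : HasCollapsingCombination h (fun j : {j // p j} ↦ deg j) (fun j ↦ F j)) :
    HasCollapsingCombination h' deg F := by
  classical
  obtain ⟨e, α, ⟨j₀, hj₀⟩, hα, g, hg, hmem⟩ := H
  refine ⟨e, fun j ↦ if hj : p j then α ⟨j, hj⟩ else 0, ⟨j₀, by simpa [j₀.2] using hj₀⟩, ?_,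
    fun q ↦ if hq : (q.1 : ℕ) < h then g (⟨q.1, hq⟩, q.2) else 0, ?_, ?_⟩
  · intro j hj
    by_cases hpj : p j
    · exact hα ⟨j, hpj⟩ (by simpa [hpj] using hj)
    · simp [hpj] at hj
  · intro q
    dsimp only
    split_ifs
    · exact hg _
    · exact isHomogeneous_zero _ _ _
  · have : ∑ j, C (if hj : p j then α ⟨j, hj⟩ else 0) * F j =
        ∑ j : {j // p j}, C (α j) * F j := by
      rw [← Fintype.sum_subtype_add_sum_subtype p, add_eq_left.mpr]
      · exact Finset.sum_congr (by ext; simp) fun j _ ↦ by rw [dif_pos j.2]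
      · exact Finset.sum_eq_zero fun j _ ↦ by rw [dif_neg j.2, C_0, zero_mul]
    rw [this]
    refine Ideal.span_mono ?_ hmem
    rintro _ ⟨q, rfl⟩
    exact ⟨(Fin.castLE hh q.1, q.2), by simp⟩

theorem isRnSequence_of_not_hasCollapsingCombination {K : Type*} [Field K] [IsAlgClosed K]
    {N s : ℕ} (η : ℕ) {F : Fin s → MvPolynomial (Fin N) K} {deg : Fin s → ℕ}
    (hdeg : ∀ j, 0 < deg j) (hF : ∀ j, (F j).IsHomogeneous (deg j))
    (h : ¬ HasCollapsingCombination (η + s) deg F) : IsRnSequence η F := by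
  classical
  refine ⟨fun htop ↦ ?_, fun i _ ↦ ?_⟩
  · have : Ideal.span (Set.range F) ≤ RingHom.ker (constantCoeff (R := K) (σ := Fin N)) := by
      rw [Ideal.span_le]
      rintro _ ⟨j, rfl⟩
      rw [SetLike.mem_coe, RingHom.mem_ker, constantCoeff_eq]
      exact (hF j).coeff_eq_zero (by simpa using (hdeg j).ne)
    rw [htop, top_le_iff] at this
    exact RingHom.ker_ne_top _ this
  · rw [Set.image_eq_range]
    refine serreConditionR_of_not_hasCollapsingCombination η (deg := fun j ↦ deg j)
      (fun j ↦ hdeg j) (fun j ↦ hF j) fun H ↦ h (H.of_subtype (fun j : Fin s ↦ (j : ℕ) < i) ?_)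
    gcongr
    exact (Fintype.card_subtype_le (fun j : Fin s ↦ (j : ℕ) < i)).trans_eq (Fintype.card_fin s)

theorem MvPolynomial.homogeneousComponent_mul_of_isHomogeneous_right {R σ : Type*}
    [CommSemiring R] {i n : ℕ}
    (f : MvPolynomial σ R) {g : MvPolynomial σ R} (hg : g.IsHomogeneous i) (hi : i ≤ n) :
    homogeneousComponent n (f * g) = homogeneousComponent (n - i) f * g := by
  let : GradedAlgebra (homogeneousSubmodule σ R) := gradedAlgebra
  have := DirectSum.coe_decompose_mul_of_right_mem_of_le (homogeneousSubmodule σ R) (a := f)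
    ((mem_homogeneousSubmodule _ _).mpr hg) hi
  simp only [← decomposition.decompose'_apply]
  exact this

theorem MvPolynomial.IsHomogeneous.exists_eq_sum_mul_of_mem_span {R σ κ : Type*} [CommSemiring R]
    [Fintype κ] {e : ℕ} {x : MvPolynomial σ R} (hx : x.IsHomogeneous e)
    {g : κ → MvPolynomial σ R} {k : κ → ℕ} (hg : ∀ p, (g p).IsHomogeneous (k p))
    (hk : ∀ p, k p ≤ e) (hmem : x ∈ Ideal.span (Set.range g)) :
    ∃ h : κ → MvPolynomial σ R, (∀ p, (h p).IsHomogeneous (e - k p)) ∧ x = ∑ p, h p * g p := by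
  obtain ⟨c, rfl⟩ := (Ideal.mem_span_range_iff_exists_fun).mp hmem
  refine ⟨fun p ↦ homogeneousComponent (e - k p) (c p),
    fun p ↦ homogeneousComponent_isHomogeneous _ _, ?_⟩
  have := homogeneousComponent_of_mem (m := e) (n := e) ((mem_homogeneousSubmodule _ _).mpr hx)
  rw [if_pos rfl] at this
  rw [← this, map_sum]
  exact Finset.sum_congr rfl fun p _ ↦
    homogeneousComponent_mul_of_isHomogeneous_right _ (hg p) (hk p)

/-- The degrees of the forms that replace a form of degree `e` in a family with degrees `m`
when it is written as a combination of `c` products for every way of splitting its degree. -/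
def replaceDegree (c e : ℕ) (m : Multiset ℕ) : Multiset ℕ :=
  m.erase e + (Finset.univ.val.map (fun p : Fin c × Fin (e - 1) ↦ (p.2 + 1 : ℕ)) +
    Finset.univ.val.map (fun p : Fin c × Fin (e - 1) ↦ e - (p.2 + 1 : ℕ)))

theorem isDershowitzMannaLT_replaceDegree (c : ℕ) {e : ℕ} {m : Multiset ℕ} (he : e ∈ m) :
    Multiset.IsDershowitzMannaLT (replaceDegree c e m) m := by
  refine ⟨m.erase e, _, {e}, Multiset.singleton_ne_zero e, rfl, ?_, ?_⟩
  · rw [add_comm, Multiset.singleton_add, Multiset.cons_erase he]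
  · intro y hy
    refine ⟨e, Multiset.mem_singleton_self e, ?_⟩
    rw [Multiset.mem_add, Multiset.mem_map, Multiset.mem_map] at hy
    obtain ⟨p, -, rfl⟩ | ⟨p, -, rfl⟩ := hy <;> have := p.2.2 <;> lia

theorem univ_val_map_eq_sum {κ α : Type*} [Fintype κ] (f : κ → α) :
    Finset.univ.val.map f = ∑ j, {f j} := by
  exact ((congrArg Multiset.sum (Multiset.map_map (fun x ↦ ({x} : Multiset α)) f _)).symm.trans
    (Multiset.sum_map_singleton _)).symm

universe u

theorem exists_bound_isRnSequence (η d : ℕ) (m : Multiset ℕ) :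
    ∃ C : ℕ, ∀ (K : Type u) [Field K] [IsAlgClosed K] (N : ℕ) (ι : Type) [Fintype ι]
      (F : ι → MvPolynomial (Fin N) K) (deg : ι → ℕ), Finset.univ.val.map deg = m →
      (∀ j, 0 < deg j ∧ deg j ≤ d) → (∀ j, (F j).IsHomogeneous (deg j)) →
      ∃ (B : ℕ) (G : Fin B → MvPolynomial (Fin N) K), B ≤ C ∧
        (∀ j, ∃ e, 0 < e ∧ e ≤ d ∧ (G j).IsHomogeneous e) ∧ IsRnSequence η G ∧
        ∀ j, F j ∈ Algebra.adjoin K (Set.range G) := by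
  classical
  have hwf : WellFounded (Multiset.IsDershowitzMannaLT (α := ℕ)) :=
    Multiset.wellFounded_isDershowitzMannaLT
  induction m using hwf.induction with | _ m ih
  choose! C hC using fun e he ↦ ih _ (isDershowitzMannaLT_replaceDegree (η + m.card) (e := e) he)
  refine ⟨max m.card (m.toFinset.sup C), fun K _ _ N ι _ F deg hm hdeg hF ↦ ?_⟩
  have hcard : m.card = Fintype.card ι := by rw [← hm]; simp
  let E := Fintype.equivFinOfCardEq hcard.symm
  by_cases H : HasCollapsingCombination (η + m.card) (deg ∘ E.symm) (F ∘ E.symm)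
  swap
  · refine ⟨_, F ∘ E.symm, le_max_left _ _, fun j ↦ ⟨_, (hdeg _).1, (hdeg _).2, hF _⟩,
      isRnSequence_of_not_hasCollapsingCombination η (fun j ↦ (hdeg _).1) (fun j ↦ hF _) H,
      fun j ↦ Algebra.subset_adjoin ⟨E j, by simp⟩⟩
  obtain ⟨e, α, ⟨i₀, hi₀⟩, hα, g, hg, hmem⟩ := H
  set j₀ := E.symm i₀ with hj₀
  set β := fun j ↦ α (E j) with hβ
  have hβ₀ : β j₀ ≠ 0 := by simpa [hβ, hj₀] using hi₀
  have hβe (j) (hj : β j ≠ 0) : deg j = e := by simpa using hα _ hj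
  have hsum : ∑ i, MvPolynomial.C (α i) * (F ∘ E.symm) i = ∑ j, MvPolynomial.C (β j) * F j := by
    rw [← E.sum_comp]
    simp [hβ]
  rw [hsum] at hmem
  have he : e ∈ m := by
    rw [← hm, Multiset.mem_map]
    exact ⟨j₀, Finset.mem_univ _, hβe _ hβ₀⟩
  have hhom : (∑ j, MvPolynomial.C (β j) * F j).IsHomogeneous e := by
    refine IsHomogeneous.sum _ _ _ fun j _ ↦ ?_
    by_cases hj : β j = 0
    · simpa [hj] using isHomogeneous_zero _ _ _
    · simpa [hβe j hj] using (isHomogeneous_C _ (β j)).mul (hF j)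
  obtain ⟨h, hh, hx⟩ := hhom.exists_eq_sum_mul_of_mem_span hg (fun p ↦ by have := p.2.2; lia) hmem
  let F' : {j // j ≠ j₀} ⊕ (Fin (η + m.card) × Fin (e - 1) ⊕ Fin (η + m.card) × Fin (e - 1)) →
      MvPolynomial (Fin N) K := Sum.elim (fun j ↦ F j) (Sum.elim g h)
  let deg' : {j // j ≠ j₀} ⊕ (Fin (η + m.card) × Fin (e - 1) ⊕ Fin (η + m.card) × Fin (e - 1)) →
      ℕ := Sum.elim (fun j ↦ deg j) (Sum.elim (fun p ↦ p.2 + 1) (fun p ↦ e - (p.2 + 1)))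
  have hed : e ≤ d := hβe _ hβ₀ ▸ (hdeg _).2
  have hmap : Finset.univ.val.map deg' = replaceDegree (η + m.card) e m := by
    have hme : m.erase e = Finset.univ.val.map fun j : {j // j ≠ j₀} ↦ deg j := by
      rw [← hβe _ hβ₀, ← hm, univ_val_map_eq_sum, univ_val_map_eq_sum,
        Fintype.sum_eq_add_sum_subtype_ne _ j₀, Multiset.singleton_add, Multiset.erase_cons_head]
    rw [replaceDegree, hme]
    simp only [univ_val_map_eq_sum, Fintype.sum_sum_type, deg', Sum.elim_inl, Sum.elim_inr]
  have hdeg' (j) : 0 < deg' j ∧ deg' j ≤ d := by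
    obtain j | p | p := j
    · exact hdeg j
    · have := p.2.2
      simp only [deg', Sum.elim_inr, Sum.elim_inl]
      lia
    · have := p.2.2
      simp only [deg', Sum.elim_inr]
      lia
  have hF' (j) : (F' j).IsHomogeneous (deg' j) := by
    obtain j | p | p := j
    · exact hF j
    · exact hg p
    · exact hh p
  obtain ⟨B, G, hB, hGdeg, hG, hFG⟩ := hC e he K N _ F' deg' hmap hdeg' hF'
  refine ⟨B, G, hB.trans (le_max_of_le_right (Finset.le_sup (Multiset.mem_toFinset.mpr he))),
    hGdeg, hG, fun j ↦ ?_⟩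
  by_cases hj : j = j₀
  · subst hj
    have hmem' : MvPolynomial.C (β j₀) * F j₀ ∈ Algebra.adjoin K (Set.range G) := by
      rw [Fintype.sum_eq_add_sum_subtype_ne _ j₀, ← eq_sub_iff_add_eq] at hx
      refine hx ▸ sub_mem (sum_mem fun p _ ↦ mul_mem (hFG (Sum.inr (Sum.inr p)))
        (hFG (Sum.inr (Sum.inl p)))) (sum_mem fun i _ ↦ mul_mem
          (algebraMap_mem _ (β i)) (hFG (Sum.inl i)))
    have := mul_mem (algebraMap_mem (Algebra.adjoin K (Set.range G)) (β j₀)⁻¹) hmem'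
    rwa [algebraMap_eq, ← mul_assoc, ← C_mul, inv_mul_cancel₀ hβ₀, C_1, one_mul] at this
  · exact hFG (Sum.inl ⟨j, hj⟩)

/-- For all positive `η`, `n`, `d` there is an integer `cB`, independent of
`N` and `K`, such that for every algebraically closed field `K` and every graded subspace `V`
of `K[x_1, …, x_N]` of dimension at most `n` spanned by forms of positive degree at most `d`,
the elements of `V` lie in a subring `K[G_1, …, G_B]` where `B ≤ cB` and `G_1, …, G_B` is an
`R_η`-sequence of forms of positive degree at most `d`. -/
theorem statement6 (η n d : ℕ) (hη : 0 < η) (hn : 0 < n) (hd : 0 < d) :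
    ∃ cB : ℕ,
      ∀ (K : Type u) [Field K] [IsAlgClosed K] (N : ℕ)
        (V : Fin d → Submodule K (MvPolynomial (Fin N) K)),
        (∀ i, V i ≤ homogeneousSubmodule (Fin N) K ((i : ℕ) + 1)) →
        (∀ i, FiniteDimensional K (V i)) →
        (∑ i, Module.finrank K (V i)) ≤ n →
        ∃ (B : ℕ) (G : Fin B → MvPolynomial (Fin N) K),
          B ≤ cB ∧
          (∀ j, ∃ e : ℕ, 0 < e ∧ e ≤ d ∧ (G j).IsHomogeneous e) ∧
          IsRnSequence η G ∧
          ∀ F ∈ (⨆ i, V i : Submodule K (MvPolynomial (Fin N) K)),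
            F ∈ Algebra.adjoin K (Set.range G) := by
  classical
  choose C hC using exists_bound_isRnSequence.{u} η d
  let S : Finset (Multiset ℕ) := (Finset.range (n + 1)).biUnion fun k ↦
    (Finset.univ : Finset (Fin k → Fin d)).image fun f ↦
      Finset.univ.val.map fun j ↦ (f j : ℕ) + 1
  refine ⟨S.sup C, fun K _ _ N V hV hfin hn' ↦ ?_⟩
  let b (i) := Module.finBasis K (V i)
  let ι := Σ i, Fin (Module.finrank K (V i))
  let F : ι → MvPolynomial (Fin N) K := fun j ↦ b j.1 j.2
  let deg : ι → ℕ := fun j ↦ (j.1 : ℕ) + 1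
  obtain ⟨B, G, hB, hGdeg, hG, hFG⟩ := hC (Finset.univ.val.map deg) K N ι F deg rfl
    (fun j ↦ ⟨Nat.succ_pos _, j.1.2⟩)
    (fun j ↦ (mem_homogeneousSubmodule _ _).mp (hV _ (b j.1 j.2).2))
  refine ⟨B, G, hB.trans (Finset.le_sup ?_), hGdeg, hG, fun x hx ↦ ?_⟩
  · have hcard : Fintype.card ι ≤ n := by simpa [ι] using hn'
    refine Finset.mem_biUnion.mpr ⟨Fintype.card ι, Finset.mem_range.mpr (by lia),
      Finset.mem_image.mpr ⟨fun j ↦ ((Fintype.equivFin ι).symm j).1, Finset.mem_univ _, ?_⟩⟩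
    rw [univ_val_map_eq_sum, univ_val_map_eq_sum]
    exact (Fintype.equivFin ι).symm.sum_comp fun j ↦ ({deg j} : Multiset ℕ)
  · have hle : ⨆ i, V i ≤ Subalgebra.toSubmodule (Algebra.adjoin K (Set.range G)) := by
      refine iSup_le fun i y hy ↦ ?_
      have hsum : ∑ j, ((b i).repr ⟨y, hy⟩ j • b i j : V i).1 = y := by
        rw [← Submodule.coe_sum, (b i).sum_repr]
      exact hsum ▸ sum_mem fun j _ ↦ Submodule.smul_mem _ _ (hFG ⟨i, j⟩)
    exact hle hx
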